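/- Let G = (V,E,w) be a weighted graph on n vertices with total edge weight W, let δ ∈ (0,1), and let S_t be a random subset of V in which each vertex is included independently with probability t/n. Then with probability at least 1 − δ over the draw of S_t, |(1/n²)·SDP(G) − (1/t²)·SDP(G[S_t])| ≤ ((n−t)/(n²t))·(SDP(G) − W/2) + (W/t²)·√(log(2/δ)). -/

import Mathlib

open scoped Classical
open Real Matrix

noncomputable section

/-- The Laplacian `L = D − A` of a weighted graph given by its weight matrix. -/
def lap {V : Type*} [Fintype V] (w : Matrix V V ℝ) : Matrix V V ℝ :=
  Matrix.of fun i j => if i = j then ∑ k, w i k else -(w i j)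

/-- The optimal value of the Goemans–Williamson SDP relaxation of max-cut:
`max (1/4)·Tr(L_G X)` over PSD matrices `X` with unit diagonal. -/
def sdpVal {V : Type*} [Fintype V] (w : Matrix V V ℝ) : ℝ :=
  sSup { v : ℝ | ∃ X : Matrix V V ℝ, X.PosSemidef ∧ (∀ i, X i i = 1) ∧
    v = (1 / 4) * (lap w * X).trace }

/-- The weight matrix of the vertex-induced subgraph `G[S]`. -/
def subw {n : ℕ} (w : Matrix (Fin n) (Fin n) ℝ) (S : Finset (Fin n)) :
    Matrix {i // i ∈ S} {i // i ∈ S} ℝ :=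
  Matrix.of fun i j => w i j

/-- The total edge weight `W = Σ_{(i,j)∈E} w_ij` (each undirected edge counted once). -/
def totalW {n : ℕ} (w : Matrix (Fin n) (Fin n) ℝ) : ℝ := (1 / 2) * ∑ i, ∑ j, w i j

/-- `E_{S_t}[SDP(G[S_t])]` where each vertex of `G` is kept independently with probability
`p`. -/
def esdp {n : ℕ} (w : Matrix (Fin n) (Fin n) ℝ) (p : ℝ) : ℝ :=
  ∑ S : Finset (Fin n), p ^ S.card * (1 - p) ^ (n - S.card) * sdpVal (subw w S)

/-- `G = (V,E,w)` is a weighted graph: symmetric nonnegative weights and no self-loops. -/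
def IsWeightedGraph {n : ℕ} (w : Matrix (Fin n) (Fin n) ℝ) : Prop :=
  (∀ i j, w i j = w j i) ∧ (∀ i j, 0 ≤ w i j) ∧ (∀ i, w i i = 0)

/-! ### The SDP objective -/

/-- The GW objective `(1/4) Σ_{i,j} w_ij (1 − X_ij)` of a unit-diagonal matrix `X`. -/
def sdpObj {V : Type*} [Fintype V] (w X : Matrix V V ℝ) : ℝ :=
  (1 / 4) * ∑ i, ∑ j, w i j * (1 - X i j)

lemma trace_lap_mul {V : Type*} [Fintype V] {w : Matrix V V ℝ} (hd : ∀ i, w i i = 0)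
    {X : Matrix V V ℝ} (hX : X.PosSemidef) (h1 : ∀ i, X i i = 1) :
    (1 / 4) * (lap w * X).trace = sdpObj w X := by
  unfold sdpObj
  congr 1
  simp only [Matrix.trace, Matrix.diag, Matrix.mul_apply, lap, Matrix.of_apply]
  refine Finset.sum_congr rfl fun i _ => ?_
  have hsym : ∀ j, X j i = X i j := fun j => by simpa using hX.isHermitian.apply i j
  have : ∀ j, (if i = j then ∑ k, w i k else -(w i j)) * X j i =
      (if i = j then ∑ k, w i k else 0) - w i j * X i j := by
    intro j
    by_cases h : i = j
    · subst h; simp [hd, h1]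
    · simp [h, hsym]
  simp_rw [this, mul_sub, Finset.sum_sub_distrib]
  simp

lemma abs_apply_le_one_of_posSemidef {V : Type*} [Fintype V] {X : Matrix V V ℝ}
    (hX : X.PosSemidef) (h1 : ∀ i, X i i = 1) (i j : V) : |X i j| ≤ 1 := by
  have hsub := (hX.submatrix ![i, j]).det_nonneg
  have hsym : X j i = X i j := by simpa using hX.isHermitian.apply i j
  rw [Matrix.det_fin_two] at hsub
  simp [h1, hsym] at hsub
  exact abs_le_one_iff_mul_self_le_one.mpr hsub

lemma sdpObj_le_sum {V : Type*} [Fintype V] {w X : Matrix V V ℝ} (h0 : ∀ i j, 0 ≤ w i j)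
    (hX : X.PosSemidef) (h1 : ∀ i, X i i = 1) :
    sdpObj w X ≤ (1 / 4) * ∑ i, ∑ j, w i j * 2 := by
  unfold sdpObj
  gcongr with i _ j _
  · exact h0 i j
  · linarith [(abs_le.mp (abs_apply_le_one_of_posSemidef hX h1 i j)).1]

lemma sdpObj_le_sdpVal {V : Type*} [Fintype V] {w X : Matrix V V ℝ} (h0 : ∀ i j, 0 ≤ w i j)
    (hd : ∀ i, w i i = 0) (hX : X.PosSemidef) (h1 : ∀ i, X i i = 1) :
    sdpObj w X ≤ sdpVal w := by
  refine le_csSup ⟨(1 / 4) * ∑ i, ∑ j, w i j * 2, ?_⟩ ⟨X, hX, h1, (trace_lap_mul hd hX h1).symm⟩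
  rintro v ⟨Y, hY, hY1, rfl⟩
  rw [trace_lap_mul hd hY hY1]
  exact sdpObj_le_sum h0 hY hY1

lemma exists_sdpVal_le_sdpObj_add {V : Type*} [Fintype V] {w : Matrix V V ℝ}
    (hd : ∀ i, w i i = 0) {ε : ℝ} (hε : 0 < ε) :
    ∃ X : Matrix V V ℝ, X.PosSemidef ∧ (∀ i, X i i = 1) ∧ sdpVal w ≤ sdpObj w X + ε := by
  have hne : { v : ℝ | ∃ X : Matrix V V ℝ, X.PosSemidef ∧ (∀ i, X i i = 1) ∧
      v = (1 / 4) * (lap w * X).trace }.Nonempty :=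
    ⟨_, 1, Matrix.PosSemidef.one, fun i => Matrix.one_apply_eq i, rfl⟩
  obtain ⟨v, ⟨X, hX, h1, rfl⟩, hv⟩ := exists_lt_of_lt_csSup hne (sub_lt_self (sdpVal w) hε)
  refine ⟨X, hX, h1, ?_⟩
  rw [trace_lap_mul hd hX h1] at hv
  linarith

/-- The part of the GW objective coming from edges inside `S`. -/
def sdpObjOn {n : ℕ} (w X : Matrix (Fin n) (Fin n) ℝ) (S : Finset (Fin n)) : ℝ :=
  (1 / 4) * ∑ i ∈ S, ∑ j ∈ S, w i j * (1 - X i j)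

lemma sdpObj_subw {n : ℕ} (w X : Matrix (Fin n) (Fin n) ℝ) (S : Finset (Fin n)) :
    sdpObj (subw w S) (X.submatrix Subtype.val Subtype.val) = sdpObjOn w X S := by
  unfold sdpObj sdpObjOn subw
  rw [← Finset.sum_coe_sort S]
  congr 1
  refine Finset.sum_congr rfl fun i _ => ?_
  rw [← Finset.sum_coe_sort S]
  rfl

lemma sdpObjOn_le_sdpVal {n : ℕ} {w X : Matrix (Fin n) (Fin n) ℝ} (hw : IsWeightedGraph w)
    (hX : X.PosSemidef) (h1 : ∀ i, X i i = 1) (S : Finset (Fin n)) :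
    sdpObjOn w X S ≤ sdpVal (subw w S) := by
  rw [← sdpObj_subw]
  exact sdpObj_le_sdpVal (fun i j => hw.2.1 i j) (fun i => hw.2.2 i) (hX.submatrix _)
    (fun i => h1 i)

/-- A unit-diagonal PSD matrix on `S` extends to one on all vertices. -/
lemma exists_posSemidef_extension {n : ℕ} {S : Finset (Fin n)}
    {Y : Matrix {i // i ∈ S} {i // i ∈ S} ℝ} (hY : Y.PosSemidef) (h1 : ∀ i, Y i i = 1) :
    ∃ X : Matrix (Fin n) (Fin n) ℝ, X.PosSemidef ∧ (∀ i, X i i = 1) ∧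
      X.submatrix Subtype.val Subtype.val = Y := by
  let P : Matrix (Fin n) {i // i ∈ S} ℝ := Matrix.of fun i s => if s.1 = i then 1 else 0
  have hin : ∀ a b : {i // i ∈ S}, (P * Y * Pᴴ) a.1 b.1 = Y a b := by
    intro a b
    simp [P, Matrix.mul_apply]
  have hout : ∀ i, i ∉ S → ∀ j, (P * Y * Pᴴ) i j = 0 := by
    intro i hi j
    have : ∀ s : {i // i ∈ S}, P i s = 0 := by
      intro s
      have : s.1 ≠ i := fun h => hi (h ▸ s.2)
      simp [P, this]
    simp [Matrix.mul_apply, this]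
  refine ⟨P * Y * Pᴴ + Matrix.diagonal fun i => if i ∈ S then 0 else 1,
    (hY.mul_mul_conjTranspose_same P).add (Matrix.PosSemidef.diagonal fun i => ?_), ?_, ?_⟩
  · simp only [Pi.zero_apply]; split_ifs <;> norm_num
  · intro i
    by_cases hi : i ∈ S
    · simpa [hi, h1] using hin ⟨i, hi⟩ ⟨i, hi⟩
    · rw [Matrix.add_apply, hout i hi i]
      simp [hi]
  · ext a b
    rw [Matrix.submatrix_apply, Matrix.add_apply, hin, Matrix.diagonal_apply]
    simp

lemma exists_sdpVal_subw_le {n : ℕ} {w : Matrix (Fin n) (Fin n) ℝ} (hw : IsWeightedGraph w)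
    (S : Finset (Fin n)) {ε : ℝ} (hε : 0 < ε) :
    ∃ X : Matrix (Fin n) (Fin n) ℝ, X.PosSemidef ∧ (∀ i, X i i = 1) ∧
      sdpVal (subw w S) ≤ sdpObjOn w X S + ε := by
  obtain ⟨Y, hY, h1, hv⟩ := exists_sdpVal_le_sdpObj_add (w := subw w S) (fun i => hw.2.2 i) hε
  obtain ⟨X, hX, hX1, rfl⟩ := exists_posSemidef_extension hY h1
  exact ⟨X, hX, hX1, by rwa [sdpObj_subw] at hv⟩

lemma sdpObjOn_insert {n : ℕ} {w X : Matrix (Fin n) (Fin n) ℝ} (hw : IsWeightedGraph w)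
    (hX : X.PosSemidef) {a : Fin n} {S : Finset (Fin n)} (ha : a ∉ S) :
    sdpObjOn w X (insert a S) = sdpObjOn w X S + (1 / 2) * ∑ j ∈ S, w a j * (1 - X a j) := by
  have hsym : ∀ j, X j a = X a j := fun j => by simpa using hX.isHermitian.apply a j
  unfold sdpObjOn
  simp_rw [Finset.sum_insert ha, Finset.sum_add_distrib, hw.2.2, hsym, fun j => hw.1 j a]
  ring

lemma sdpVal_subw_le_insert {n : ℕ} {w : Matrix (Fin n) (Fin n) ℝ} (hw : IsWeightedGraph w)
    {a : Fin n} {S : Finset (Fin n)} (ha : a ∉ S) :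
    sdpVal (subw w S) ≤ sdpVal (subw w (insert a S)) := by
  refine le_of_forall_pos_le_add fun ε hε => ?_
  obtain ⟨X, hX, h1, hv⟩ := exists_sdpVal_subw_le hw S hε
  have h2 := sdpObjOn_le_sdpVal hw hX h1 (insert a S)
  rw [sdpObjOn_insert hw hX ha] at h2
  have h3 : 0 ≤ ∑ j ∈ S, w a j * (1 - X a j) := Finset.sum_nonneg fun j _ =>
    mul_nonneg (hw.2.1 a j)
      (by linarith [(abs_le.mp (abs_apply_le_one_of_posSemidef hX h1 a j)).2])
  linarith

lemma sdpVal_subw_insert_le {n : ℕ} {w : Matrix (Fin n) (Fin n) ℝ} (hw : IsWeightedGraph w)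
    {a : Fin n} {S : Finset (Fin n)} (ha : a ∉ S) :
    sdpVal (subw w (insert a S)) ≤ sdpVal (subw w S) + ∑ j, w a j := by
  refine le_of_forall_pos_le_add fun ε hε => ?_
  obtain ⟨X, hX, h1, hv⟩ := exists_sdpVal_subw_le hw (insert a S) hε
  have h2 := sdpObjOn_le_sdpVal hw hX h1 S
  rw [sdpObjOn_insert hw hX ha] at hv
  have h3 : ∑ j ∈ S, w a j * (1 - X a j) ≤ ∑ j ∈ S, w a j * 2 := by
    gcongr with j _
    · exact hw.2.1 a j
    · linarith [(abs_le.mp (abs_apply_le_one_of_posSemidef hX h1 a j)).1]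
  have h4 : ∑ j ∈ S, w a j ≤ ∑ j, w a j :=
    Finset.sum_le_sum_of_subset_of_nonneg (Finset.subset_univ S) fun j _ _ => hw.2.1 a j
  rw [← Finset.sum_mul] at h3
  linarith

/-! ### Expectation over a random subset -/

/-- The expectation of `f` over a random subset of `s` keeping each element with
probability `p`. -/
def subsetExp {α : Type*} (p : ℝ) (s : Finset α) (f : Finset α → ℝ) : ℝ :=
  ∑ T ∈ s.powerset, p ^ T.card * (1 - p) ^ (s.card - T.card) * f T

lemma subsetExp_insert {α : Type*} [DecidableEq α] (p : ℝ) {a : α} {s : Finset α} (ha : a ∉ s)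
    (f : Finset α → ℝ) :
    subsetExp p (insert a s) f =
      subsetExp p s fun T => (1 - p) * f T + p * f (insert a T) := by
  unfold subsetExp
  rw [Finset.sum_powerset_insert ha, ← Finset.sum_add_distrib]
  refine Finset.sum_congr rfl fun T hT => ?_
  have hTs := Finset.mem_powerset.mp hT
  rw [Finset.card_insert_of_notMem ha, Finset.card_insert_of_notMem fun h => ha (hTs h),
    Nat.add_sub_add_right, Nat.succ_sub (Finset.card_le_card hTs), pow_succ, pow_succ]
  ring

lemma subsetExp_mono {α : Type*} {p : ℝ} (hp0 : 0 ≤ p) (hp1 : p ≤ 1) {s : Finset α}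
    {f g : Finset α → ℝ} (h : ∀ T ⊆ s, f T ≤ g T) : subsetExp p s f ≤ subsetExp p s g := by
  unfold subsetExp
  refine Finset.sum_le_sum fun T hT => ?_
  have : 0 ≤ 1 - p := by linarith
  exact mul_le_mul_of_nonneg_left (h T (Finset.mem_powerset.mp hT)) (by positivity)

lemma subsetExp_add {α : Type*} (p : ℝ) (s : Finset α) (f g : Finset α → ℝ) :
    subsetExp p s (fun T => f T + g T) = subsetExp p s f + subsetExp p s g := by
  simp [subsetExp, mul_add, Finset.sum_add_distrib]

lemma subsetExp_const_mul {α : Type*} (p : ℝ) (s : Finset α) (c : ℝ) (f : Finset α → ℝ) :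
    subsetExp p s (fun T => c * f T) = c * subsetExp p s f := by
  unfold subsetExp
  rw [Finset.mul_sum]
  exact Finset.sum_congr rfl fun T _ => by ring

lemma subsetExp_sum {α ι : Type*} (p : ℝ) (s : Finset α) (I : Finset ι)
    (f : ι → Finset α → ℝ) :
    subsetExp p s (fun T => ∑ i ∈ I, f i T) = ∑ i ∈ I, subsetExp p s (f i) := by
  unfold subsetExp
  rw [Finset.sum_comm]
  simp_rw [Finset.mul_sum]

/-- A random subset contains a fixed set `A` with probability `p ^ |A|`. -/
lemma subsetExp_superset {α : Type*} [DecidableEq α] (p : ℝ) (s : Finset α) :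
    ∀ A ⊆ s, subsetExp p s (fun T => if A ⊆ T then 1 else 0) = p ^ A.card := by
  induction s using Finset.induction_on with
  | empty =>
    intro A hA
    obtain rfl := Finset.subset_empty.mp hA
    simp [subsetExp]
  | insert a s ha ih =>
    intro A hA
    rw [subsetExp_insert p ha]
    have hA' : A.erase a ⊆ s := by rwa [← Finset.subset_insert_iff]
    by_cases haA : a ∈ A
    · rw [← Finset.card_erase_add_one haA, pow_succ, ← ih _ hA', mul_comm, ← subsetExp_const_mul]
      unfold subsetExp
      refine Finset.sum_congr rfl fun T hT => ?_
      have haT : a ∉ T := fun h => ha (Finset.mem_powerset.mp hT h)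
      have h1 : ¬ A ⊆ T := fun h => haT (h haA)
      simp [h1, Finset.subset_insert_iff]
    · rw [Finset.erase_eq_of_notMem haA] at hA'
      rw [← ih _ hA']
      congr 1
      ext T
      simp only [Finset.subset_insert_iff, Finset.erase_eq_of_notMem haA]
      ring

lemma subsetExp_const {α : Type*} (p : ℝ) (s : Finset α) (c : ℝ) :
    subsetExp p s (fun _ => c) = c := by
  have h := subsetExp_superset p s ∅ (Finset.empty_subset s)
  simp only [Finset.empty_subset, if_true, Finset.card_empty, pow_zero] at h
  simpa [h] using subsetExp_const_mul p s c fun _ => 1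

/-! ### McDiarmid's inequality -/

/-- Hoeffding's lemma for a Bernoulli variable. -/
lemma bernoulli_exp_le {p : ℝ} (hp0 : 0 ≤ p) (hp1 : p ≤ 1) (u : ℝ) :
    (1 - p) * Real.exp (-(p * u)) + p * Real.exp ((1 - p) * u) ≤ Real.exp (u ^ 2 / 8) := by
  have hq : 0 ≤ 1 - p := by linarith
  let μ : MeasureTheory.Measure ℝ := ENNReal.ofReal (1 - p) • MeasureTheory.Measure.dirac 0 +
    ENNReal.ofReal p • MeasureTheory.Measure.dirac 1
  have hint : ∀ g : ℝ → ℝ, ∫ x, g x ∂μ = (1 - p) * g 0 + p * g 1 := by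
    intro g
    have hi : ∀ (a q : ℝ), MeasureTheory.Integrable g
        (ENNReal.ofReal q • MeasureTheory.Measure.dirac a) := fun a q =>
      (MeasureTheory.integrable_dirac (by finiteness)).smul_measure ENNReal.ofReal_ne_top
    rw [MeasureTheory.integral_add_measure (hi _ _) (hi _ _),
      MeasureTheory.integral_smul_measure, MeasureTheory.integral_smul_measure,
      MeasureTheory.integral_dirac, MeasureTheory.integral_dirac,
      ENNReal.toReal_ofReal hq, ENNReal.toReal_ofReal hp0, smul_eq_mul, smul_eq_mul]
  have : MeasureTheory.IsProbabilityMeasure μ := ⟨by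
    simp [μ, ← ENNReal.ofReal_add hq hp0]⟩
  have hsupp : ∀ᵐ x ∂μ, x - p ∈ Set.Icc (-p) (1 - p) := by
    refine MeasureTheory.ae_add_measure_iff.mpr
      ⟨MeasureTheory.Measure.ae_smul_measure ?_ _, MeasureTheory.Measure.ae_smul_measure ?_ _⟩ <;>
    simp [MeasureTheory.ae_dirac_eq]
  have hsub := ProbabilityTheory.hasSubgaussianMGF_of_mem_Icc_of_integral_eq_zero (μ := μ)
    (X := fun x => x - p) (by fun_prop) hsupp (by rw [hint]; ring)
  have hmgf := hsub.mgf_le u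
  rw [ProbabilityTheory.mgf, hint] at hmgf
  convert hmgf using 2
  · ring_nf
  · ring_nf
  · simp
    ring

lemma two_point_exp_le {p : ℝ} (hp0 : 0 ≤ p) (hp1 : p ≤ 1) {x y c : ℝ} (h : |y - x| ≤ c)
    (l m : ℝ) :
    (1 - p) * Real.exp (l * (x - m)) + p * Real.exp (l * (y - m)) ≤
      Real.exp (l ^ 2 * c ^ 2 / 8) * Real.exp (l * ((1 - p) * x + p * y - m)) := by
  have h1 := bernoulli_exp_le hp0 hp1 (l * (y - x))
  have h2 : Real.exp ((l * (y - x)) ^ 2 / 8) ≤ Real.exp (l ^ 2 * c ^ 2 / 8) := by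
    rw [mul_pow, ← sq_abs (y - x)]
    gcongr
  calc _ = ((1 - p) * Real.exp (-(p * (l * (y - x)))) + p * Real.exp ((1 - p) * (l * (y - x)))) *
        Real.exp (l * ((1 - p) * x + p * y - m)) := by
        rw [add_mul, mul_assoc, mul_assoc, ← Real.exp_add, ← Real.exp_add]
        ring_nf
    _ ≤ _ := by gcongr; exact h1.trans h2

/-- The exponential-moment form of McDiarmid's inequality for a random subset. -/
lemma subsetExp_exp_le {α : Type*} [DecidableEq α] {p : ℝ} (hp0 : 0 ≤ p) (hp1 : p ≤ 1)
    (c : α → ℝ) (l : ℝ) (s : Finset α) :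
    ∀ f : Finset α → ℝ, (∀ a ∈ s, ∀ T ⊆ s, a ∉ T → |f (insert a T) - f T| ≤ c a) →
      subsetExp p s (fun T => Real.exp (l * (f T - subsetExp p s f))) ≤
        Real.exp (l ^ 2 * (∑ a ∈ s, c a ^ 2) / 8) := by
  induction s using Finset.induction_on with
  | empty => intro f _; simp [subsetExp]
  | insert a s ha ih =>
    intro f hf
    set g : Finset α → ℝ := fun T => (1 - p) * f T + p * f (insert a T) with hg
    have hgdiff : ∀ b ∈ s, ∀ T ⊆ s, b ∉ T → |g (insert b T) - g T| ≤ c b := by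
      intro b hb T hT hbT
      have hba : b ≠ a := fun h => ha (h ▸ hb)
      have h1 := hf b (Finset.mem_insert_of_mem hb) T
        (hT.trans (Finset.subset_insert a s)) hbT
      have h2 := hf b (Finset.mem_insert_of_mem hb) (insert a T)
        (Finset.insert_subset_insert a hT) (by simp [hba, hbT])
      rw [Finset.insert_comm] at h2
      have h3 : g (insert b T) - g T = (1 - p) * (f (insert b T) - f T) +
          p * (f (insert a (insert b T)) - f (insert a T)) := by simp only [hg]; ring
      rw [h3]
      rw [abs_le] at *
      constructor <;> nlinarith
    have key := ih g hgdiff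
    rw [subsetExp_insert p ha f, subsetExp_insert p ha, Finset.sum_insert ha]
    calc _ ≤ subsetExp p s fun T => Real.exp (l ^ 2 * c a ^ 2 / 8) *
            Real.exp (l * (g T - subsetExp p s g)) :=
          subsetExp_mono hp0 hp1 fun T hT => two_point_exp_le hp0 hp1
            (hf a (Finset.mem_insert_self a s) T (hT.trans (Finset.subset_insert a s))
              fun h => ha (hT h)) l _
      _ = Real.exp (l ^ 2 * c a ^ 2 / 8) *
            subsetExp p s fun T => Real.exp (l * (g T - subsetExp p s g)) :=
          subsetExp_const_mul _ _ _ _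
      _ ≤ Real.exp (l ^ 2 * c a ^ 2 / 8) * Real.exp (l ^ 2 * (∑ b ∈ s, c b ^ 2) / 8) := by
          gcongr
      _ = _ := by rw [← Real.exp_add]; ring_nf

/-- McDiarmid's inequality for a random subset, with squared differences summing to at most
`2 K ^ 2`. -/
lemma one_sub_le_subsetExp_abs_sub_le {α : Type*} [DecidableEq α] {p : ℝ} (hp0 : 0 ≤ p)
    (hp1 : p ≤ 1) {c : α → ℝ} {s : Finset α} {f : Finset α → ℝ}
    (hf : ∀ a ∈ s, ∀ T ⊆ s, a ∉ T → |f (insert a T) - f T| ≤ c a)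
    {K : ℝ} (hK : 0 < K) (hc : ∑ a ∈ s, c a ^ 2 ≤ 2 * K ^ 2) {δ : ℝ} (hδ0 : 0 < δ)
    (hδ1 : δ < 1) :
    1 - δ ≤ subsetExp p s fun T =>
      if |f T - subsetExp p s f| ≤ K * √(Real.log (2 / δ)) then 1 else 0 := by
  set r := √(Real.log (2 / δ)) with hr
  set m := subsetExp p s f with hm
  have hr2 : r ^ 2 = Real.log (2 / δ) :=
    Real.sq_sqrt (Real.log_nonneg (by rw [le_div_iff₀ hδ0]; linarith))
  have hr0 : 0 ≤ r := Real.sqrt_nonneg _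
  have hexp : Real.exp (-r ^ 2) = δ / 2 := by
    rw [hr2, Real.exp_neg, Real.exp_log (by positivity), inv_div]
  have tail : ∀ l : ℝ, l ^ 2 = (2 * r / K) ^ 2 →
      subsetExp p s (fun T => Real.exp (-(2 * r ^ 2)) * Real.exp (l * (f T - m))) ≤ δ / 2 := by
    intro l hl
    rw [subsetExp_const_mul, ← hexp]
    calc _ ≤ Real.exp (-(2 * r ^ 2)) * Real.exp (l ^ 2 * (∑ a ∈ s, c a ^ 2) / 8) := by
          gcongr; exact subsetExp_exp_le hp0 hp1 c l s f hf
      _ ≤ Real.exp (-(2 * r ^ 2)) * Real.exp (l ^ 2 * (2 * K ^ 2) / 8) := by gcongr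
      _ = _ := by
          rw [← Real.exp_add, hl]
          congr 1
          field_simp
          ring
  have hpt : ∀ T ⊆ s, 1 ≤ (if |f T - m| ≤ K * r then (1 : ℝ) else 0) +
      (Real.exp (-(2 * r ^ 2)) * Real.exp ((2 * r / K) * (f T - m)) +
        Real.exp (-(2 * r ^ 2)) * Real.exp (-(2 * r / K) * (f T - m))) := by
    intro T _
    split_ifs with h
    · have : 0 < Real.exp (-(2 * r ^ 2)) * Real.exp ((2 * r / K) * (f T - m)) +
        Real.exp (-(2 * r ^ 2)) * Real.exp (-(2 * r / K) * (f T - m)) := by positivity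
      linarith
    · have hkr : 2 * r / K * (K * r) = 2 * r ^ 2 := by field_simp
      have hq : 0 ≤ 2 * r / K := by positivity
      rw [← Real.exp_add, ← Real.exp_add, zero_add]
      rcases lt_abs.mp (not_le.mp h) with h | h
      · have h1 := mul_le_mul_of_nonneg_left h.le hq
        have h2 := Real.one_le_exp
          (show 0 ≤ -(2 * r ^ 2) + 2 * r / K * (f T - m) by linarith)
        have h3 := Real.exp_pos (-(2 * r ^ 2) + -(2 * r / K) * (f T - m))
        linarith
      · have h1 := mul_le_mul_of_nonneg_left h.le hq
        have h2 := Real.one_le_exp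
          (show 0 ≤ -(2 * r ^ 2) + -(2 * r / K) * (f T - m) by linarith)
        have h3 := Real.exp_pos (-(2 * r ^ 2) + 2 * r / K * (f T - m))
        linarith
  have hall := subsetExp_mono hp0 hp1 hpt
  rw [subsetExp_const, subsetExp_add, subsetExp_add] at hall
  have h1 := tail (2 * r / K) rfl
  have h2 := tail (-(2 * r / K)) (neg_sq _)
  linarith

/-! ### The expected SDP value of a random induced subgraph -/

lemma sum_sum_mem_eq {n : ℕ} (S : Finset (Fin n)) (F : Fin n → Fin n → ℝ) :
    ∑ i ∈ S, ∑ j ∈ S, F i j = ∑ i, ∑ j, F i j * if {i, j} ⊆ S then 1 else 0 := by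
  simp only [Finset.insert_subset_iff, Finset.singleton_subset_iff, ite_and, mul_ite, mul_one,
    mul_zero]
  simp [Finset.sum_ite_mem]

lemma subsetExp_sum_sum {n : ℕ} {w : Matrix (Fin n) (Fin n) ℝ} (hw : IsWeightedGraph w)
    (p : ℝ) (X : Matrix (Fin n) (Fin n) ℝ) :
    subsetExp p Finset.univ (fun S => ∑ i ∈ S, ∑ j ∈ S, w i j * X i j) =
      p ^ 2 * ∑ i, ∑ j, w i j * X i j := by
  rw [funext fun S => sum_sum_mem_eq S fun i j => w i j * X i j]
  simp_rw [subsetExp_sum, subsetExp_const_mul, Finset.mul_sum]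
  refine Finset.sum_congr rfl fun i _ => Finset.sum_congr rfl fun j _ => ?_
  rw [subsetExp_superset p _ _ (Finset.subset_univ _)]
  by_cases h : i = j
  · subst h; simp [hw.2.2]
  · rw [Finset.card_pair h]; ring

lemma le_subsetExp_sdpVal {n : ℕ} {w : Matrix (Fin n) (Fin n) ℝ} (hw : IsWeightedGraph w)
    {p : ℝ} (hp0 : 0 ≤ p) (hp1 : p ≤ 1) :
    p ^ 2 * sdpVal w ≤ subsetExp p Finset.univ fun S => sdpVal (subw w S) := by
  refine le_of_forall_pos_le_add fun ε hε => ?_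
  obtain ⟨X, hX, h1, hv⟩ := exists_sdpVal_le_sdpObj_add (w := w) hw.2.2 hε
  have h2 := subsetExp_mono hp0 hp1 (s := Finset.univ)
    fun S _ => sdpObjOn_le_sdpVal hw hX h1 S
  have h3 : subsetExp p Finset.univ (fun S => sdpObjOn w X S) = p ^ 2 * sdpObj w X := by
    unfold sdpObjOn sdpObj
    have := subsetExp_sum_sum hw p (Matrix.of fun i j => 1 - X i j)
    simp only [Matrix.of_apply] at this
    rw [subsetExp_const_mul, this]
    ring
  rw [h3] at h2
  have h4 : p ^ 2 ≤ 1 := pow_le_one₀ hp0 hp1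
  nlinarith [sq_nonneg p]

lemma subsetExp_sdpVal_le {n : ℕ} {w : Matrix (Fin n) (Fin n) ℝ} (hw : IsWeightedGraph w)
    {p : ℝ} (hp0 : 0 < p) (hp1 : p ≤ 1) :
    (subsetExp p Finset.univ fun S => sdpVal (subw w S)) ≤
      p ^ 2 * (totalW w / 2) + p * (sdpVal w - totalW w / 2) := by
  refine le_of_forall_pos_le_add fun ε hε => ?_
  choose X hX h1 hv using fun S => exists_sdpVal_subw_le hw S hε
  let d : Finset (Fin n) → Fin n → ℝ := fun S i => if i ∈ S then 1 else 0
  let μ : Finset (Fin n) → ℝ := fun S => p ^ S.card * (1 - p) ^ (n - S.card)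
  have hμ : ∀ S, 0 ≤ μ S := fun S => by
    have : 0 ≤ 1 - p := by linarith
    positivity
  let Y : Matrix (Fin n) (Fin n) ℝ :=
    p⁻¹ • ∑ S, μ S • (Matrix.diagonal (d S) * X S * (Matrix.diagonal (d S))ᴴ)
  have hYapp : ∀ i j, Y i j =
      p⁻¹ * subsetExp p Finset.univ fun S => X S i j * if {i, j} ⊆ S then 1 else 0 := by
    intro i j
    simp only [Y, subsetExp, μ, d, Matrix.smul_apply, Matrix.sum_apply, smul_eq_mul,
      Finset.powerset_univ, Finset.card_univ, Fintype.card_fin]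
    congr 1
    refine Finset.sum_congr rfl fun S _ => ?_
    simp only [Matrix.diagonal_conjTranspose, Matrix.diagonal_mul, Matrix.mul_diagonal]
    by_cases hi : i ∈ S <;> by_cases hj : j ∈ S <;> simp [hi, hj, Finset.insert_subset_iff]
  have hYpsd : Y.PosSemidef :=
    (Matrix.posSemidef_sum _ fun S _ =>
      ((hX S).mul_mul_conjTranspose_same _).smul (hμ S)).smul (inv_nonneg.mpr hp0.le)
  have hY1 : ∀ i, Y i i = 1 := by
    intro i
    rw [hYapp]
    simp only [h1, one_mul]
    rw [subsetExp_superset p _ _ (Finset.subset_univ _)]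
    simp [hp0.ne']
  have hval := sdpObj_le_sdpVal hw.2.1 hw.2.2 hYpsd hY1
  have hsum : ∑ i, ∑ j, w i j = 2 * totalW w := by unfold totalW; ring
  have hobj : sdpObj w Y = totalW w / 2 - (1 / 4) * ∑ i, ∑ j, w i j * Y i j := by
    simp only [sdpObj, mul_sub, mul_one, Finset.sum_sub_distrib, hsum]
    ring
  have hXY : subsetExp p Finset.univ (fun S => ∑ i ∈ S, ∑ j ∈ S, w i j * X S i j) =
      p * ∑ i, ∑ j, w i j * Y i j := by
    rw [funext fun S => sum_sum_mem_eq S fun i j => w i j * X S i j]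
    simp_rw [subsetExp_sum, mul_assoc, subsetExp_const_mul, Finset.mul_sum, hYapp]
    refine Finset.sum_congr rfl fun i _ => Finset.sum_congr rfl fun j _ => ?_
    field_simp
  have hE : subsetExp p Finset.univ (fun S => sdpObjOn w (X S) S) =
      p ^ 2 * (totalW w / 2) - (1 / 4) * (p * ∑ i, ∑ j, w i j * Y i j) := by
    have hsplit : ∀ S, sdpObjOn w (X S) S = (1 / 4) * ∑ i ∈ S, ∑ j ∈ S, w i j * 1 +
        (-(1 / 4)) * ∑ i ∈ S, ∑ j ∈ S, w i j * X S i j := by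
      intro S
      simp only [sdpObjOn, mul_sub, Finset.sum_sub_distrib]
      ring
    have hone := subsetExp_sum_sum hw p (Matrix.of fun _ _ => 1)
    simp only [Matrix.of_apply] at hone
    simp_rw [hsplit]
    rw [subsetExp_add, subsetExp_const_mul, subsetExp_const_mul, hXY, hone]
    simp only [mul_one, hsum]
    ring
  have hfin := subsetExp_mono hp0.le hp1 (s := Finset.univ) fun S _ => hv S
  rw [subsetExp_add, subsetExp_const, hE] at hfin
  have := mul_le_mul_of_nonneg_left hval hp0.le
  rw [hobj] at this
  linarith

lemma sum_le_totalW {n : ℕ} {w : Matrix (Fin n) (Fin n) ℝ} (hw : IsWeightedGraph w)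
    (a : Fin n) : ∑ j, w a j ≤ totalW w := by
  have h1 : ∑ i, ∑ j, w i j = ∑ j, w a j + ∑ i ∈ Finset.univ.erase a, ∑ j, w i j :=
    (Finset.add_sum_erase _ _ (Finset.mem_univ a)).symm
  have h2 : ∑ i ∈ Finset.univ.erase a, w i a ≤ ∑ i ∈ Finset.univ.erase a, ∑ j, w i j :=
    Finset.sum_le_sum fun i _ =>
      Finset.single_le_sum (f := fun j => w i j) (fun j _ => hw.2.1 i j) (Finset.mem_univ a)
  have h3 : ∑ j, w a j = w a a + ∑ i ∈ Finset.univ.erase a, w i a := by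
    rw [← Finset.add_sum_erase _ _ (Finset.mem_univ a)]
    simp_rw [fun i => hw.1 i a]
  unfold totalW
  rw [hw.2.2] at h3
  linarith

lemma sum_sq_degree_le {n : ℕ} {w : Matrix (Fin n) (Fin n) ℝ} (hw : IsWeightedGraph w) :
    ∑ a, (∑ j, w a j) ^ 2 ≤ 2 * totalW w ^ 2 := by
  calc ∑ a, (∑ j, w a j) ^ 2 ≤ ∑ a, totalW w * ∑ j, w a j := by
        refine Finset.sum_le_sum fun a _ => ?_
        rw [sq]
        exact mul_le_mul_of_nonneg_right (sum_le_totalW hw a)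
          (Finset.sum_nonneg fun j _ => hw.2.1 a j)
    _ = 2 * totalW w ^ 2 := by rw [← Finset.mul_sum]; unfold totalW; ring

lemma sdpVal_eq_zero {V : Type*} [Fintype V] {w : Matrix V V ℝ} (h : ∀ i j, w i j = 0) :
    sdpVal w = 0 := by
  have h2 := sdpObj_le_sdpVal (w := w) (fun i j => (h i j).ge) (fun i => h i i)
    Matrix.PosSemidef.one fun i => Matrix.one_apply_eq i
  refine le_antisymm (le_of_forall_pos_le_add fun ε hε => ?_) (by simpa [sdpObj, h] using h2)
  obtain ⟨X, -, -, h1⟩ := exists_sdpVal_le_sdpObj_add (w := w) (fun i => h i i) hε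
  simpa [sdpObj, h] using h1

/-- With probability at least `1 − δ`, `SDP(G[S])` deviates from its mean by at most
`W √(log (2/δ))`. -/
lemma one_sub_le_subsetExp_sdpVal {n : ℕ} {w : Matrix (Fin n) (Fin n) ℝ}
    (hw : IsWeightedGraph w) {p : ℝ} (hp0 : 0 ≤ p) (hp1 : p ≤ 1) {δ : ℝ} (hδ0 : 0 < δ)
    (hδ1 : δ < 1) :
    1 - δ ≤ subsetExp p Finset.univ fun S =>
      if |sdpVal (subw w S) - subsetExp p Finset.univ fun T => sdpVal (subw w T)| ≤
        totalW w * √(Real.log (2 / δ)) then 1 else 0 := by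
  have hdeg : ∀ a, 0 ≤ ∑ j, w a j := fun a => Finset.sum_nonneg fun j _ => hw.2.1 a j
  have hW : 0 ≤ totalW w := mul_nonneg (by norm_num) (Finset.sum_nonneg fun a _ => hdeg a)
  rcases hW.eq_or_lt with hW | hW
  · have hzero : ∀ i j, w i j = 0 := fun i j => le_antisymm
      ((Finset.single_le_sum (f := fun j => w i j) (fun j _ => hw.2.1 i j)
        (Finset.mem_univ j)).trans ((sum_le_totalW hw i).trans hW.ge)) (hw.2.1 i j)
    have hs : ∀ S, sdpVal (subw w S) = 0 := fun S => sdpVal_eq_zero fun i j => hzero i j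
    simp only [hs, subsetExp_const, ← hW]
    simp [hδ0.le]
  · refine one_sub_le_subsetExp_abs_sub_le hp0 hp1 (c := fun a => ∑ j, w a j) ?_ hW
      (sum_sq_degree_le hw) hδ0 hδ1
    intro a _ T _ haT
    rw [abs_le]
    constructor <;>
      linarith [sdpVal_subw_le_insert hw haT, sdpVal_subw_insert_le hw haT, hdeg a]

/-- For a weighted graph `G` on `n` vertices with total edge weight `W`,
`δ ∈ (0,1)`, and a random subset `S_t` keeping each vertex independently with probability
`t/n`, with probability at least `1 − δ`,
`|(1/n²)·SDP(G) − (1/t²)·SDP(G[S_t])| ≤ ((n−t)/(n²t))·(SDP(G) − W/2) + (W/t²)·√(log(2/δ))`. -/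
theorem stmt16 {n : ℕ} (hn : 0 < n) (w : Matrix (Fin n) (Fin n) ℝ)
    (hw : IsWeightedGraph w) (t : ℝ) (ht : 0 < t) (htn : t ≤ n)
    (δ : ℝ) (hδ0 : 0 < δ) (hδ1 : δ < 1) :
    1 - δ ≤
      ∑ S : Finset (Fin n),
        if |(1 / (n : ℝ) ^ 2) * sdpVal w - (1 / t ^ 2) * sdpVal (subw w S)| ≤
            (((n : ℝ) - t) / ((n : ℝ) ^ 2 * t)) * (sdpVal w - totalW w / 2) +
              (totalW w / t ^ 2) * Real.sqrt (Real.log (2 / δ))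
        then (t / n) ^ S.card * (1 - t / n) ^ (n - S.card)
        else 0 := by
  have hn' : (0 : ℝ) < n := by exact_mod_cast hn
  set p : ℝ := t / n with hp
  have hp0 : 0 < p := by positivity
  have hp1 : p ≤ 1 := (div_le_one hn').mpr htn
  refine (one_sub_le_subsetExp_sdpVal hw hp0.le hp1 hδ0 hδ1).trans ?_
  have hlow := le_subsetExp_sdpVal hw hp0.le hp1
  have hupp := subsetExp_sdpVal_le hw hp0 hp1
  set m := subsetExp p Finset.univ fun T => sdpVal (subw w T) with hm
  have ht_eq : t = p * n := by rw [hp]; field_simp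
  unfold subsetExp
  simp only [Finset.powerset_univ, Finset.card_univ, Fintype.card_fin]
  refine Finset.sum_le_sum fun S _ => ?_
  have h1p : 0 ≤ 1 - p := by linarith
  have hμ : 0 ≤ p ^ S.card * (1 - p) ^ (n - S.card) := by positivity
  by_cases h : |sdpVal (subw w S) - m| ≤ totalW w * √(Real.log (2 / δ))
  · rw [if_pos h, if_pos, mul_one]
    have e1 : (1 / (n : ℝ) ^ 2) * sdpVal w - (1 / t ^ 2) * sdpVal (subw w S) =
        (1 / t ^ 2) * (p ^ 2 * sdpVal w - sdpVal (subw w S)) := by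
      rw [ht_eq]; field_simp
    have e2 : (((n : ℝ) - t) / ((n : ℝ) ^ 2 * t)) * (sdpVal w - totalW w / 2) +
        (totalW w / t ^ 2) * √(Real.log (2 / δ)) =
        (1 / t ^ 2) * (p * (1 - p) * (sdpVal w - totalW w / 2) +
          totalW w * √(Real.log (2 / δ))) := by
      rw [ht_eq]; field_simp
    rw [e1, e2, abs_mul, abs_of_pos (by positivity : 0 < 1 / t ^ 2)]
    refine mul_le_mul_of_nonneg_left ?_ (by positivity)
    rw [abs_le] at h ⊢
    constructor <;> nlinarith
  · rw [if_neg h, mul_zero]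
    split_ifs
    · exact hμ
    · exact le_rfl
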